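/- Asymptotic calibration formula: under the Gaussian covariance assumptions above, for ℓ ∈ (0,1) the calibration of the logistic predictor f̂(x) = σ(ŵᵀx) (σ the sigmoid) satisfies Δ_ℓ := ℓ − P(y = 1 | f̂(x) = ℓ) = ℓ − E_{z ~ N((m/q)σ^{-1}(ℓ), ρ − m²/q)}[σ*(z/T*)], and the expected calibration error equals ECE = ∫ |Δ_{σ(ξ)}| N(ξ | 0, q) dξ. -/

import Mathlib

open MeasureTheory ProbabilityTheory

/-- The logistic sigmoid. -/
noncomputable def sigmoid (t : ℝ) : ℝ := 1 / (1 + Real.exp (-t))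

/-- If every linear combination `a X + b Y` is centered Gaussian with variance `a² s + b² t`, then
`(X, Y)` has the product law `N(0, s) ⊗ N(0, t)`. -/
theorem map_prodMk_eq_prod_gaussianReal {Ω : Type*} [MeasurableSpace Ω] {μ : Measure Ω}
    [IsProbabilityMeasure μ] {X Y : Ω → ℝ} (hX : Measurable X) (hY : Measurable Y)
    {s t : ℝ} (hs : 0 ≤ s) (ht : 0 ≤ t)
    (hXY : ∀ a b : ℝ, μ.map (fun ω => a * X ω + b * Y ω) =
      gaussianReal 0 (a ^ 2 * s + b ^ 2 * t).toNNReal) :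
    μ.map (fun ω => (X ω, Y ω)) = (gaussianReal 0 s.toNNReal).prod (gaussianReal 0 t.toNNReal) := by
  have hXm : μ.map X = gaussianReal 0 s.toNNReal := by simpa using hXY 1 0
  have hYm : μ.map Y = gaussianReal 0 t.toNNReal := by simpa using hXY 0 1
  have hlin (L : StrongDual ℝ (ℝ × ℝ)) (x y : ℝ) : L (x, y) = L (1, 0) * x + L (0, 1) * y := by
    have : (x, y) = x • ((1 : ℝ), (0 : ℝ)) + y • ((0 : ℝ), (1 : ℝ)) := by simp
    rw [this, map_add, map_smul, map_smul]
    simp [mul_comm]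
  rw [← hXm, ← hYm, ← indepFun_iff_map_prod_eq_prod_map_map hX.aemeasurable hY.aemeasurable,
    indepFun_iff_charFunDual_prod hX.aemeasurable hY.aemeasurable]
  intro L
  have h₁ : L.comp (.inl ℝ ℝ ℝ) ∘ X = fun ω => L (1, 0) * X ω + 0 * Y ω := by
    funext ω; simp [hlin L (X ω) 0]
  have h₂ : L.comp (.inr ℝ ℝ ℝ) ∘ Y = fun ω => 0 * X ω + L (0, 1) * Y ω := by
    funext ω; simp [hlin L 0 (Y ω)]
  have h₃ : L ∘ (fun ω => (X ω, Y ω)) = fun ω => L (1, 0) * X ω + L (0, 1) * Y ω := by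
    funext ω; exact hlin L _ _
  rw [charFunDual_eq_charFun_map_one, charFunDual_eq_charFun_map_one,
    charFunDual_eq_charFun_map_one, Measure.map_map (by fun_prop) (by fun_prop),
    Measure.map_map (by fun_prop) hX, Measure.map_map (by fun_prop) hY, h₁, h₂, h₃, hXY, hXY, hXY,
    charFun_gaussianReal, charFun_gaussianReal, charFun_gaussianReal, ← Complex.exp_add,
    Real.coe_toNNReal _ (by positivity), Real.coe_toNNReal _ (by positivity),
    Real.coe_toNNReal _ (by positivity)]
  congr 1
  push_cast
  ring

/-- Asymptotic calibration formula: for the logistic predictor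
`f̂(x) = σ(ŵᵀx)` with `(u, v) = (w*ᵀx, ŵᵀx)` centered bivariate Gaussian with
covariance `[[ρ, m], [m, q]]` and labels `P(y=1|x) = σ*(u/T*)`, the conditional
probability `h ξ = P(y = 1 | v = ξ)` satisfies, for a.e. `ξ ~ N(0,q)`,
`h ξ = E_{z ~ N((m/q)ξ, ρ − m²/q)}[σ*(z/T*)]`, i.e.
`Δ_ℓ = ℓ − E_{z ~ N((m/q)σ⁻¹(ℓ), ρ − m²/q)}[σ*(z/T*)]` with `ℓ = σ(ξ)`;
and the expected calibration error `E_x |Δ_{f̂(x)}|` equals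
`∫ |Δ_{σ(ξ)}| N(ξ | 0, q) dξ`. -/
theorem stmt9 {Ω : Type*} [MeasurableSpace Ω] (μ : Measure Ω) [IsProbabilityMeasure μ]
    (u v : Ω → ℝ) (y : Ω → ℤ) (hu : Measurable u) (hv : Measurable v) (hy : Measurable y)
    (ρ m q : ℝ) (hq : 0 < q) (hpos : ρ * q - m ^ 2 ≥ 0)
    (hjoint : ∀ a b : ℝ, μ.map (fun ω => a * u ω + b * v ω) =
      gaussianReal 0 (a ^ 2 * ρ + 2 * a * b * m + b ^ 2 * q).toNNReal)
    (σstar : ℝ → ℝ) (hσ : Measurable σstar) (hσ01 : ∀ t, σstar t ∈ Set.Ioo (0:ℝ) 1)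
    (Tstar : ℝ) (hT : 0 < Tstar)
    (hlabel : ∀ B : Set ℝ, MeasurableSet B →
      (μ {ω | y ω = 1 ∧ v ω ∈ B}).toReal =
        ∫ ω, Set.indicator B (fun _ => (1:ℝ)) (v ω) * σstar (u ω / Tstar) ∂μ)
    (h : ℝ → ℝ) (hh : Measurable h)
    (hhcond : ∀ B : Set ℝ, MeasurableSet B →
      (μ {ω | y ω = 1 ∧ v ω ∈ B}).toReal = ∫ ξ in B, h ξ ∂gaussianReal 0 q.toNNReal) :
    (∀ᵐ ξ ∂gaussianReal 0 q.toNNReal,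
        h ξ = ∫ z, σstar (z / Tstar) ∂gaussianReal ((m / q) * ξ) (ρ - m ^ 2 / q).toNNReal) ∧
    ∫ ω, |sigmoid (v ω) - h (v ω)| ∂μ =
      ∫ ξ, |sigmoid ξ - h ξ| ∂gaussianReal 0 q.toNNReal := by
  have hs : 0 ≤ ρ - m ^ 2 / q := by
    have : ρ - m ^ 2 / q = (ρ * q - m ^ 2) / q := by field_simp
    rw [this]
    exact div_nonneg hpos hq.le
  have hvq : μ.map v = gaussianReal 0 q.toNNReal := by simpa using hjoint 0 1
  have hprod : μ.map (fun ω => (v ω, u ω - m / q * v ω)) =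
      (gaussianReal 0 q.toNNReal).prod (gaussianReal 0 (ρ - m ^ 2 / q).toNNReal) := by
    refine map_prodMk_eq_prod_gaussianReal hv (by fun_prop) hq.le hs fun a b => ?_
    convert hjoint b (a - b * (m / q)) using 3
    · ring
    · field_simp; ring
  refine ⟨?_, ?_⟩
  swap
  · rw [← hvq, integral_map hv.aemeasurable]
    unfold sigmoid
    exact Measurable.aestronglyMeasurable (by fun_prop)
  set ν := gaussianReal 0 q.toNNReal
  set κ := gaussianReal 0 (ρ - m ^ 2 / q).toNNReal
  have hbound (t : ℝ) : ‖σstar t‖ ≤ 1 := by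
    rw [Real.norm_eq_abs, abs_of_pos (hσ01 t).1]
    exact (hσ01 t).2.le
  have hshift (ξ : ℝ) : ∫ z, σstar (z / Tstar) ∂gaussianReal (m / q * ξ) (ρ - m ^ 2 / q).toNNReal =
      ∫ w, σstar ((w + m / q * ξ) / Tstar) ∂κ := by
    have hmap : κ.map (· + m / q * ξ) =
        gaussianReal (m / q * ξ) (ρ - m ^ 2 / q).toNNReal := by
      simp [κ, gaussianReal_map_add_const]
    rw [← hmap, integral_map (by fun_prop) (Measurable.aestronglyMeasurable (by fun_prop))]
  simp_rw [hshift]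
  have hF : Measurable fun p : ℝ × ℝ => σstar ((p.2 + m / q * p.1) / Tstar) := by fun_prop
  have hFint : Integrable (fun p : ℝ × ℝ => σstar ((p.2 + m / q * p.1) / Tstar)) (ν.prod κ) :=
    Integrable.of_bound hF.aestronglyMeasurable 1 (.of_forall fun _ => hbound _)
  have hg : Integrable (fun ξ => ∫ w, σstar ((w + m / q * ξ) / Tstar) ∂κ) ν :=
    hFint.integral_prod_left
  have hset (B : Set ℝ) (hB : MeasurableSet B) :
      ∫ ξ in B, h ξ ∂ν = ∫ ξ in B, ∫ w, σstar ((w + m / q * ξ) / Tstar) ∂κ ∂ν := by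
    have hG : Measurable fun p : ℝ × ℝ =>
        (B.indicator (fun _ => (1 : ℝ)) p.1) * σstar ((p.2 + m / q * p.1) / Tstar) :=
      ((measurable_const.indicator hB).comp measurable_fst).mul hF
    have hGint : Integrable (fun p : ℝ × ℝ =>
        (B.indicator (fun _ => (1 : ℝ)) p.1) * σstar ((p.2 + m / q * p.1) / Tstar)) (ν.prod κ) := by
      refine Integrable.of_bound hG.aestronglyMeasurable 1 (.of_forall fun p => ?_)
      by_cases hp : p.1 ∈ B <;> simp [hp, -Real.norm_eq_abs, hbound]
    calc ∫ ξ in B, h ξ ∂ν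
        = ∫ ω, B.indicator (fun _ => (1 : ℝ)) (v ω) * σstar (u ω / Tstar) ∂μ := by
          rw [← hhcond B hB, hlabel B hB]
      _ = ∫ p, B.indicator (fun _ => (1 : ℝ)) p.1 * σstar ((p.2 + m / q * p.1) / Tstar)
            ∂ν.prod κ := by
          rw [← hprod, integral_map (by fun_prop) hG.aestronglyMeasurable]
          simp
      _ = ∫ ξ, B.indicator (fun ξ => ∫ w, σstar ((w + m / q * ξ) / Tstar) ∂κ) ξ ∂ν := by
          rw [integral_prod _ hGint]
          congr 1 with ξ
          by_cases hξ : ξ ∈ B <;> simp [hξ]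
      _ = _ := integral_indicator hB
  have hh_int : Integrable h ν := by
    by_contra hcon
    have hzero : ∫ p, σstar ((p.2 + m / q * p.1) / Tstar) ∂ν.prod κ = 0 := by
      have := hset Set.univ .univ
      rw [setIntegral_univ, setIntegral_univ, integral_undef hcon] at this
      rw [integral_prod _ hFint, ← this]
    rw [integral_eq_zero_iff_of_nonneg (fun _ => (hσ01 _).1.le) hFint] at hzero
    obtain ⟨p, hp⟩ := hzero.exists
    exact (hσ01 _).1.ne' hp
  exact hh_int.ae_eq_of_forall_setIntegral_eq _ _ hg fun B hB _ => hset B hB
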